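/- arXiv:2409.16447 — 4 statements merged into one kernel-verified Lean document; each statement's English description precedes it below -/
import Mathlib

section
/- Let p be a prime and F a field of characteristic p. Let β₁,…,βₙ ∈ F be nonzero elements that are not p-independent, i.e., there exist elements x_d ∈ F, indexed by the tuples d = (d₁,…,dₙ) ∈ {0,1,…,p−1}ⁿ, not all zero, such that Σ_d β₁^{d₁}···βₙ^{dₙ} · x_d^p = 0. Then the form Σ_{d ≠ (0,…,0)} β₁^{d₁}···βₙ^{dₙ} · X_d^p is universal over the subfield of p-th powers: for every γ ∈ F there exist elements y_d ∈ F (indexed by the nonzero tuples d ∈ {0,1,…,p−1}ⁿ) such that Σ_{d ≠ (0,…,0)} β₁^{d₁}···βₙ^{dₙ} · y_d^p = γ^p. -/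
/-- Lemma 1 (Lemma `ourlemma`): if `β₁,…,βₙ ∈ F^×` are not `p`-independent, i.e. there is a
nontrivial relation `∑_{d ∈ {0,…,p-1}ⁿ} β₁^{d₁}⋯βₙ^{dₙ} x_d^p = 0`, then the form
`∑_{d ≠ 0} β₁^{d₁}⋯βₙ^{dₙ} X_d^p` represents every `p`-th power `γ^p`. -/
theorem universal_form_of_not_p_independent
    {p : ℕ} (hp : p.Prime) {F : Type*} [Field F] [CharP F p]
    {n : ℕ} (β : Fin n → F) (hβ : ∀ i, β i ≠ 0)
    (x : (Fin n → Fin p) → F) (hx : x ≠ 0)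
    (hdep : ∑ d : Fin n → Fin p, (∏ i, β i ^ (d i : ℕ)) * x d ^ p = 0)
    (γ : F) :
    ∃ y : (Fin n → Fin p) → F,
      ∑ d ∈ Finset.univ.filter (fun d : Fin n → Fin p => d ≠ fun _ => (⟨0, hp.pos⟩ : Fin p)),
        (∏ i, β i ^ (d i : ℕ)) * y d ^ p = γ ^ p := by
  have : Fact p.Prime := ⟨hp⟩
  have : NeZero p := ⟨hp.ne_zero⟩
  obtain ⟨e, he⟩ := Function.ne_iff.mp hx
  set z : Fin n → Fin p := fun _ => (⟨0, hp.pos⟩ : Fin p) with hz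
  have hz0 : z = 0 := by
    funext i
    apply Fin.ext
    simp [hz]
  let w : (Fin n → Fin p) → F := fun d =>
    x (d + e) * ∏ i, (β i ^ (((d i : ℕ) + (e i : ℕ)) / p))⁻¹
  have hw0 : w z ≠ 0 := by
    have h1 : z + e = e := by rw [hz0, zero_add]
    simp only [w, h1]
    refine mul_ne_zero he (Finset.prod_ne_zero_iff.mpr fun i _ => ?_)
    exact inv_ne_zero (pow_ne_zero _ (hβ i))
  have hB : (∏ i, β i ^ (e i : ℕ)) ≠ 0 :=
    Finset.prod_ne_zero_iff.mpr fun i _ => pow_ne_zero _ (hβ i)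
  have hterm : ∀ d : Fin n → Fin p,
      (∏ i, β i ^ ((d + e) i : ℕ)) * x (d + e) ^ p
        = (∏ i, β i ^ (e i : ℕ)) * ((∏ i, β i ^ (d i : ℕ)) * w d ^ p) := by
    intro d
    have key : (∏ i, β i ^ ((d + e) i : ℕ))
        = (∏ i, β i ^ (e i : ℕ)) * (∏ i, β i ^ (d i : ℕ)) *
          (∏ i, (β i ^ (((d i : ℕ) + (e i : ℕ)) / p))⁻¹) ^ p := by
      rw [← Finset.prod_pow, ← Finset.prod_mul_distrib, ← Finset.prod_mul_distrib]
      refine Finset.prod_congr rfl fun i _ => ?_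
      have h2 : ((d + e) i : ℕ) = ((d i : ℕ) + (e i : ℕ)) % p := by
        simp [Fin.val_add]
      rw [h2, inv_pow, eq_mul_inv_iff_mul_eq₀ (pow_ne_zero _ (pow_ne_zero _ (hβ i))),
        ← pow_mul, ← pow_add, ← pow_add]
      congr 1
      rw [mul_comm _ p, Nat.mod_add_div, add_comm]
    simp only [w]
    rw [key, mul_pow]
    ring
  have hsum : ∑ d : Fin n → Fin p, (∏ i, β i ^ (d i : ℕ)) * w d ^ p = 0 := by
    have h3 := Equiv.sum_comp (Equiv.addRight e)
      (fun d : Fin n → Fin p => (∏ i, β i ^ (d i : ℕ)) * x d ^ p)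
    rw [hdep] at h3
    simp only [Equiv.coe_addRight] at h3
    rw [Finset.sum_congr rfl (fun d _ => hterm d), ← Finset.mul_sum] at h3
    exact (mul_eq_zero.mp h3).resolve_left hB
  have hneg : (-1 : F) ^ p = -1 := neg_one_pow_char F p
  refine ⟨fun d => (-1) * (γ / w z) * w d, ?_⟩
  rw [Finset.filter_ne']
  have hsplit := Finset.add_sum_erase Finset.univ
    (fun d : Fin n → Fin p => (∏ i, β i ^ (d i : ℕ)) * w d ^ p) (Finset.mem_univ z)
  rw [hsum] at hsplit
  have hz1 : (∏ i, β i ^ (z i : ℕ)) = 1 := by simp [hz]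
  simp only [hz1, one_mul] at hsplit
  have h5 : ∀ d : Fin n → Fin p, (∏ i, β i ^ (d i : ℕ)) * ((-1) * (γ / w z) * w d) ^ p
      = -((γ / w z) ^ p) * ((∏ i, β i ^ (d i : ℕ)) * w d ^ p) := by
    intro d
    rw [mul_pow, mul_pow, hneg]
    ring
  rw [Finset.sum_congr rfl (fun d _ => h5 d), ← Finset.mul_sum,
    eq_neg_of_add_eq_zero_right hsplit, neg_mul_neg, ← mul_pow, div_mul_cancel₀ _ hw0]
end

section
/- Let p be a prime and F a field of characteristic p. Suppose β₁,…,βₙ ∈ F are nonzero elements that are not p-independent, i.e., there exist x_d ∈ F, indexed by d ∈ {0,1,…,p−1}ⁿ, not all zero, with Σ_d β₁^{d₁}···βₙ^{dₙ} · x_d^p = 0. Then every element α ∈ F can be written as α = λ^p − λ + Σ_{d ≠ (0,…,0)} z_d^p · β₁^{d₁}···βₙ^{dₙ} for some λ ∈ F and elements z_d ∈ F indexed by the nonzero tuples d ∈ {0,1,…,p−1}ⁿ. -/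
/-- If `β₁,…,βₙ ∈ F^×` are not `p`-independent (there is a nontrivial relation
`∑_{d ∈ {0,…,p-1}ⁿ} β₁^{d₁}⋯βₙ^{dₙ} x_d^p = 0`), then every `α ∈ F` can be written as
`α = λ^p − λ + ∑_{d ≠ 0} z_d^p β₁^{d₁}⋯βₙ^{dₙ}`. -/
theorem artin_schreier_decomposition_of_not_p_independent
    {p : ℕ} (hp : p.Prime) {F : Type*} [Field F] [CharP F p]
    {n : ℕ} (β : Fin n → F) (hβ : ∀ i, β i ≠ 0)
    (x : (Fin n → Fin p) → F) (hx : x ≠ 0)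
    (hdep : ∑ d : Fin n → Fin p, (∏ i, β i ^ (d i : ℕ)) * x d ^ p = 0)
    (α : F) :
    ∃ (l : F) (z : (Fin n → Fin p) → F),
      α = l ^ p - l +
        ∑ d ∈ Finset.univ.filter (fun d : Fin n → Fin p => d ≠ fun _ => (⟨0, hp.pos⟩ : Fin p)),
          z d ^ p * ∏ i, β i ^ (d i : ℕ) := by
  haveI : NeZero p := ⟨hp.ne_zero⟩
  obtain ⟨e, he⟩ := Function.ne_iff.mp hx
  have he' : x e ≠ 0 := he
  set Q : (Fin n → Fin p) → F :=
    fun d => ∏ i, β i ^ (((d i : ℕ) + (e i : ℕ)) / p) with hQ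
  have hQ0 : ∀ d, Q d ≠ 0 := fun d =>
    Finset.prod_ne_zero_iff.mpr fun i _ => pow_ne_zero _ (hβ i)
  have hE0 : (∏ i, β i ^ (e i : ℕ)) ≠ 0 :=
    Finset.prod_ne_zero_iff.mpr fun i _ => pow_ne_zero _ (hβ i)
  have hmul : ∀ d : Fin n → Fin p, (∏ i, β i ^ ((d + e) i : ℕ)) * Q d ^ p =
      (∏ i, β i ^ (e i : ℕ)) * ∏ i, β i ^ (d i : ℕ) := by
    intro d
    rw [hQ, ← Finset.prod_pow, ← Finset.prod_mul_distrib, ← Finset.prod_mul_distrib]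
    refine Finset.prod_congr rfl fun i _ => ?_
    rw [← pow_mul, ← pow_add, ← pow_add, Pi.add_apply, Fin.val_add]
    congr 1
    have h := Nat.mod_add_div ((d i : ℕ) + (e i : ℕ)) p
    rw [mul_comm] at h
    omega
  set y : (Fin n → Fin p) → F := fun d => x (d + e) / Q d with hy
  have hsum : ∑ d : Fin n → Fin p, y d ^ p * ∏ i, β i ^ (d i : ℕ) = 0 := by
    have h1 : (∏ i, β i ^ (e i : ℕ)) *
        ∑ d : Fin n → Fin p, y d ^ p * ∏ i, β i ^ (d i : ℕ) = 0 := by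
      rw [← hdep, ← Equiv.sum_comp (Equiv.addRight e)
        (fun d : Fin n → Fin p => (∏ i, β i ^ (d i : ℕ)) * x d ^ p), Finset.mul_sum]
      refine Finset.sum_congr rfl fun d _ => ?_
      have h2 := hmul d
      have h3 := pow_ne_zero p (hQ0 d)
      simp only [Equiv.coe_addRight]
      calc _ = y d ^ p * ((∏ i, β i ^ (e i : ℕ)) * ∏ i, β i ^ (d i : ℕ)) := by ring
        _ = _ := by
          rw [← h2, hy, div_pow]
          field_simp
    exact (mul_eq_zero.mp h1).resolve_left hE0
  set o : Fin n → Fin p := fun _ => (⟨0, hp.pos⟩ : Fin p) with ho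
  have hy0 : y o ≠ 0 := by
    have h0 : o + e = e := by
      funext i
      apply Fin.ext
      simp [ho, Fin.val_add, Nat.mod_eq_of_lt (e i).isLt]
    simp only [hy, h0]
    exact div_ne_zero he' (hQ0 _)
  have hoprod : ∏ i, β i ^ (o i : ℕ) = 1 := by simp [ho]
  refine ⟨-α, fun d => (-α / y o) * y d, ?_⟩
  have hf : Finset.univ.filter (fun d : Fin n → Fin p => d ≠ o) = Finset.univ.erase o := by
    ext d
    simp
  rw [← Finset.add_sum_erase _ _ (Finset.mem_univ o), hoprod, mul_one] at hsum
  rw [hf]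
  simp only [mul_pow, mul_assoc]
  rw [← Finset.mul_sum, eq_neg_of_add_eq_zero_right hsum, div_pow]
  have := pow_ne_zero p hy0
  field_simp
  ring
end

section
/- Let F be a field of characteristic 2, let α ∈ F, and let β₁,…,βₙ ∈ F^×. The (n+1)-fold quadratic Pfister form ⟨⟨βₙ, …, β₁, α]] over F is isotropic (equivalently, hyperbolic) if and only if α = λ² + λ + Σ_{d ≠ (0,…,0)} z_d² · β₁^{d₁}···βₙ^{dₙ} for some λ ∈ F and elements z_d ∈ F indexed by the nonzero tuples d = (d₁,…,dₙ) ∈ {0,1}ⁿ. -/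
/-- The `(n+1)`-fold quadratic Pfister form `⟨⟨βₙ,…,β₁,α]]` in characteristic 2, written
explicitly on `F^{2^{n+1}}`: coordinates are pairs `(x_S, y_S)` indexed by subsets
`S ⊆ {1,…,n}`, and
`q((x_S,y_S)_S) = ∑_S (∏_{i∈S} β_i) (x_S² + x_S y_S + α y_S²)`. -/
def pfisterFormCharTwo {F : Type*} [Field F] {n : ℕ} (β : Fin n → F) (α : F)
    (f : Finset (Fin n) → F × F) : F :=
  ∑ S : Finset (Fin n),
    (∏ i ∈ S, β i) * ((f S).1 ^ 2 + (f S).1 * (f S).2 + α * (f S).2 ^ 2)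

/-- The totally singular part `∑_S β_S x_S²`. -/
def pfB {F : Type*} [Field F] {n : ℕ} (β : Fin n → F) (x : Finset (Fin n) → F) : F :=
  ∑ S : Finset (Fin n), (∏ i ∈ S, β i) * x S ^ 2

theorem prod_key {F : Type*} [Field F] {n : ℕ} (β : Fin n → F) (S U : Finset (Fin n)) :
    (∏ i ∈ U, β i) * (∏ i ∈ S \ U, β i) ^ 2 = (∏ i ∈ S, β i) * ∏ i ∈ symmDiff S U, β i := by
  have h1 : ∏ i ∈ symmDiff S U, β i = (∏ i ∈ S \ U, β i) * ∏ i ∈ U \ S, β i := by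
    rw [← Finset.prod_union disjoint_sdiff_sdiff]
    rfl
  have h2 : (∏ i ∈ U \ S, β i) * ∏ i ∈ S, β i = (∏ i ∈ S \ U, β i) * ∏ i ∈ U, β i := by
    rw [← Finset.prod_union Finset.sdiff_disjoint, ← Finset.prod_union Finset.sdiff_disjoint,
      Finset.sdiff_union_self_eq_union, Finset.sdiff_union_self_eq_union, Finset.union_comm]
  rw [h1]
  linear_combination -(∏ i ∈ S \ U, β i) * h2

/-- Multiplication in `F[t₁,…,tₙ]/(tᵢ² = βᵢ)`. -/
theorem exists_mul {F : Type*} [Field F] [CharP F 2] {n : ℕ} (β : Fin n → F)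
    (x y : Finset (Fin n) → F) :
    ∃ m : Finset (Fin n) → F, pfB β m = pfB β x * pfB β y ∧
      m ∅ = ∑ S : Finset (Fin n), (∏ i ∈ S, β i) * (x S * y S) := by
  refine ⟨fun U => ∑ S : Finset (Fin n), (∏ i ∈ S \ U, β i) * (x S * y (symmDiff S U)), ?_, ?_⟩
  · have : Fact (Nat.Prime 2) := ⟨Nat.prime_two⟩
    unfold pfB
    rw [Finset.sum_mul_sum]
    simp only [sum_pow_char 2, Finset.mul_sum]
    rw [Finset.sum_comm]
    refine Finset.sum_congr rfl fun S _ => ?_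
    refine Finset.sum_bij' (fun U _ => symmDiff S U) (fun U _ => symmDiff S U)
      (by simp) (by simp) (by simp) (by simp) fun U _ => ?_
    linear_combination (x S * y (symmDiff S U)) ^ 2 * prod_key β S U
  · simp only [Finset.sdiff_empty]
    refine Finset.sum_congr rfl fun S _ => ?_
    have : symmDiff S (∅ : Finset (Fin n)) = S := symmDiff_bot S
    rw [this]

theorem pfB_smul {F : Type*} [Field F] {n : ℕ} (β : Fin n → F) (c : F)
    (x : Finset (Fin n) → F) : pfB β (fun S => c * x S) = c ^ 2 * pfB β x := by
  unfold pfB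
  rw [Finset.mul_sum]
  exact Finset.sum_congr rfl fun S _ => by ring

theorem pfB_nilp {F : Type*} [Field F] [CharP F 2] {n : ℕ} (α : F)
    (β : Fin n → F) (hβ : ∀ i, β i ≠ 0) (y : Finset (Fin n) → F) (hy : y ≠ 0)
    (h0 : pfB β y = 0) : ∃ x, α = pfB β x + x ∅ := by
  obtain ⟨T, hT⟩ := Function.ne_iff.mp hy
  have hT' : y T ≠ 0 := hT
  have hp : ∏ i ∈ T, β i ≠ 0 := Finset.prod_ne_zero_iff.mpr fun i _ => hβ i
  obtain ⟨m, hm, hm0⟩ := exists_mul β (fun S => if S = T then 1 else 0) y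
  have : m ∅ = (∏ i ∈ T, β i) * y T := by simp [hm0]
  refine ⟨fun S => (α / m ∅) * m S, ?_⟩
  rw [pfB_smul, hm, h0]
  have : m ∅ ≠ 0 := by rw [this]; exact mul_ne_zero hp hT'
  field_simp
  simp

theorem pfB_split {F : Type*} [Field F] {n : ℕ} (β : Fin n → F)
    (x : Finset (Fin n) → F) : pfB β x = x ∅ ^ 2 +
        ∑ S ∈ Finset.univ.filter (fun S : Finset (Fin n) => S ≠ ∅),
          x S ^ 2 * ∏ i ∈ S, β i := by
  unfold pfB
  rw [← Finset.add_sum_erase _ _ (Finset.mem_univ ∅), Finset.filter_ne']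
  simp [mul_comm]

theorem pfister_split {F : Type*} [Field F] {n : ℕ} (β : Fin n → F) (α : F)
    (f : Finset (Fin n) → F × F) : pfisterFormCharTwo β α f =
      pfB β (fun S => (f S).1) + (∑ S, (∏ i ∈ S, β i) * ((f S).1 * (f S).2)) +
        α * pfB β (fun S => (f S).2) := by
  unfold pfisterFormCharTwo pfB
  rw [Finset.mul_sum, ← Finset.sum_add_distrib, ← Finset.sum_add_distrib]
  exact Finset.sum_congr rfl fun S _ => by ring

/-- Kato/Arason–Baeza criterion: for `F` of characteristic 2, `α ∈ F` and
`β₁,…,βₙ ∈ F^×`, the quadratic Pfister form `⟨⟨βₙ,…,β₁,α]]` is isotropic if and only if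
`α = λ² + λ + ∑_{∅ ≠ S ⊆ {1,…,n}} z_S² ∏_{i∈S} β_i` for some `λ` and `z_S ∈ F`
(the nonempty subsets `S` correspond to the nonzero tuples `d ∈ {0,1}ⁿ`). -/
theorem pfister_isotropic_iff_artin_schreier
    {F : Type*} [Field F] [CharP F 2] {n : ℕ} (α : F)
    (β : Fin n → F) (hβ : ∀ i, β i ≠ 0) :
    (∃ f : Finset (Fin n) → F × F, f ≠ 0 ∧ pfisterFormCharTwo β α f = 0) ↔
    ∃ (l : F) (z : Finset (Fin n) → F),
      α = l ^ 2 + l +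
        ∑ S ∈ Finset.univ.filter (fun S : Finset (Fin n) => S ≠ ∅),
          z S ^ 2 * ∏ i ∈ S, β i := by
  constructor
  · rintro ⟨f, hf, h⟩
    suffices H : ∃ x, α = pfB β x + x ∅ by
      obtain ⟨x, hx⟩ := H
      refine ⟨x ∅, x, ?_⟩
      rw [pfB_split] at hx
      linear_combination hx
    by_cases hy0 : pfB β (fun S => (f S).2) = 0
    · by_cases hy : (fun S => (f S).2) = 0
      · have hy' : ∀ S, (f S).2 = 0 := fun S => congrFun hy S
        refine pfB_nilp α β hβ (fun S => (f S).1) ?_ ?_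
        · intro hx
          exact hf (funext fun S => Prod.ext (congrFun hx S) (hy' S))
        · rw [pfister_split, hy0] at h
          simpa [hy'] using h
      · exact pfB_nilp α β hβ _ hy hy0
    · rw [pfister_split] at h
      obtain ⟨m, hm, hm0⟩ := exists_mul β (fun S => (f S).1) (fun S => (f S).2)
      rw [← hm0] at h
      refine ⟨fun S => (pfB β (fun S => (f S).2))⁻¹ * m S, ?_⟩
      rw [pfB_smul, hm]
      field_simp
      have h2 := CharTwo.two_eq_zero (R := F)
      linear_combination h - h2 * (pfB β (fun S => (f S).1) + m ∅)
  · rintro ⟨l, z, h⟩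
    refine ⟨fun S => if S = ∅ then (l, 1) else (z S, 0), ?_, ?_⟩
    · intro hf
      have := congrArg Prod.snd (congrFun hf ∅)
      simp at this
    · unfold pfisterFormCharTwo
      rw [← Finset.add_sum_erase _ _ (Finset.mem_univ ∅)]
      rw [Finset.filter_ne'] at h
      have : ∀ S ∈ (Finset.univ : Finset (Finset (Fin n))).erase ∅,
          (∏ i ∈ S, β i) * ((if S = ∅ then (l, (1 : F)) else (z S, 0)).1 ^ 2 +
            (if S = ∅ then (l, (1 : F)) else (z S, 0)).1 *
            (if S = ∅ then (l, (1 : F)) else (z S, 0)).2 +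
            α * (if S = ∅ then (l, (1 : F)) else (z S, 0)).2 ^ 2) = z S ^ 2 * ∏ i ∈ S, β i := by
        intro S hS
        rw [if_neg (Finset.ne_of_mem_erase hS)]
        ring
      rw [Finset.sum_congr rfl this]
      simp only [if_true, Finset.prod_empty]
      have h2 := CharTwo.two_eq_zero (R := F)
      linear_combination -h + h2 * α
end

section
/- Let F be a field of characteristic 2 and let n > k ≥ 1 be integers. Let ψ be a quadratic n-fold Pfister form over F and let φ₁ and φ₂ be quadratic k-fold Pfister forms that are factors of ψ, i.e., there exist bilinear Pfister forms ρ₁ and ρ₂ with ψ ≅ ρ₁ ⊗ φ₁ and ψ ≅ ρ₂ ⊗ φ₂. Then there exists a single bilinear Pfister form ρ (an (n−k)-fold bilinear Pfister form ⟨⟨c₁,…,c_{n−k}⟩⟩ for some c₁,…,c_{n−k} ∈ F^×) such that ψ ≅ ρ ⊗ φ₁ and ψ ≅ ρ ⊗ φ₂. -/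
/-- The `(k+1)`-fold quadratic Pfister form `⟨⟨b₁,…,b_k, b₀]]` in characteristic 2, written
explicitly: coordinates are pairs `(x_S, y_S)` indexed by subsets `S ⊆ {1,…,k}`, and
`q = ∑_S (∏_{i∈S} b_i)(x_S² + x_S y_S + b₀ y_S²)`. -/
def quadPfister {F : Type*} [Field F] {k : ℕ} (b : Fin k → F) (b0 : F)
    (f : Finset (Fin k) → F × F) : F :=
  ∑ S : Finset (Fin k),
    (∏ i ∈ S, b i) * ((f S).1 ^ 2 + (f S).1 * (f S).2 + b0 * (f S).2 ^ 2)

/-- The tensor product `⟨⟨c₁,…,c_m⟩⟩ ⊗ ⟨⟨b₁,…,b_k, b₀]]` of an `m`-fold bilinear Pfister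
form (diagonal with entries `∏_{i∈T} c_i`, `T ⊆ {1,…,m}`) with a `(k+1)`-fold quadratic
Pfister form, written explicitly as a quadratic form. -/
def bilinTensorQuadPfister {F : Type*} [Field F] {m k : ℕ} (c : Fin m → F)
    (b : Fin k → F) (b0 : F)
    (f : Finset (Fin m) × Finset (Fin k) → F × F) : F :=
  ∑ T : Finset (Fin m), ∑ S : Finset (Fin k),
    (∏ i ∈ T, c i) * (∏ i ∈ S, b i) *
      ((f (T, S)).1 ^ 2 + (f (T, S)).1 * (f (T, S)).2 + b0 * (f (T, S)).2 ^ 2)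

/-- Two quadratic forms (given as functions on `F`-vector spaces) are isometric if there is
a linear equivalence of the underlying spaces transforming one into the other. -/
def QuadIsometric {F V W : Type*} [Field F] [AddCommGroup V] [Module F V]
    [AddCommGroup W] [Module F W] (q₁ : V → F) (q₂ : W → F) : Prop :=
  ∃ e : V ≃ₗ[F] W, ∀ v, q₂ (e v) = q₁ v

universe u

section PfisterAux

set_option linter.unusedSectionVars false

open QuadraticMap

variable {F : Type u} [Field F]
variable {V W V' W' : Type u} [AddCommGroup V] [Module F V] [AddCommGroup W] [Module F W]
  [AddCommGroup V'] [Module F V'] [AddCommGroup W'] [Module F W']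

/-- `⟨⟨c⟩⟩ ⊗ q`. -/
def pDbl (c : F) (q : QuadraticForm F V) : QuadraticForm F (V × V) :=
  QuadraticMap.prod q (c • q)

/-- `⟨⟨c₁,…,c_m⟩⟩ ⊗ q`. -/
def pTen {m : ℕ} (c : Fin m → F) (q : QuadraticForm F V) :
    QuadraticForm F (Finset (Fin m) → V) :=
  QuadraticMap.pi (fun T : Finset (Fin m) => (∏ i ∈ T, c i) • q)

/-- The binary form `[1, a]`. -/
def pE (a : F) : QuadraticForm F (F × F) :=
  linMulLin (LinearMap.fst F F F) (LinearMap.fst F F F) +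
    linMulLin (LinearMap.fst F F F) (LinearMap.snd F F F) +
    a • linMulLin (LinearMap.snd F F F) (LinearMap.snd F F F)

theorem pE_apply (a : F) (v : F × F) : pE a v = v.1 ^ 2 + v.1 * v.2 + a * v.2 ^ 2 := by
  simp [pE, linMulLin_apply]; ring

theorem pDbl_apply (c : F) (q : QuadraticForm F V) (v : V × V) :
    pDbl c q v = q v.1 + c * q v.2 := by
  simp [pDbl]

theorem pTen_apply {m : ℕ} (c : Fin m → F) (q : QuadraticForm F V) (f : Finset (Fin m) → V) :
    pTen c q f = ∑ T : Finset (Fin m), (∏ i ∈ T, c i) * q (f T) := by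
  simp [pTen]

theorem equiv_of {q : QuadraticForm F V} {q' : QuadraticForm F W} (e : V ≃ₗ[F] W)
    (h : ∀ v, q' (e v) = q v) : q.Equivalent q' := ⟨⟨e, h⟩⟩

theorem equiv_smul (c : F) {q : QuadraticForm F V} {q' : QuadraticForm F W}
    (h : q.Equivalent q') : (c • q).Equivalent (c • q') := by
  obtain ⟨e⟩ := h
  exact equiv_of e.toLinearEquiv (fun v => by simp)

theorem equiv_pDbl (c : F) {q : QuadraticForm F V} {q' : QuadraticForm F W}
    (h : q.Equivalent q') : (pDbl c q).Equivalent (pDbl c q') :=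
  h.prod (equiv_smul c h)

theorem equiv_pTen {m : ℕ} (c : Fin m → F) {q : QuadraticForm F V} {q' : QuadraticForm F W}
    (h : q.Equivalent q') : (pTen c q).Equivalent (pTen c q') :=
  Equivalent.pi (fun _ => equiv_smul _ h)

/-- changing the slot up to a similarity factor -/
theorem equiv_pDbl_slot {c d : F} {q : QuadraticForm F V}
    (h : (c • q).Equivalent (d • q)) : (pDbl c q).Equivalent (pDbl d q) :=
  (Equivalent.refl q).prod h

theorem pDbl_swap (c d : F) (q : QuadraticForm F V) :
    (pDbl c (pDbl d q)).Equivalent (pDbl d (pDbl c q)) :=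
  equiv_of (LinearEquiv.prodProdProdComm F V V V V) (fun v => by
    simp [pDbl_apply]; ring)

/-- Subsets of `Fin (m+1)` split according to whether they contain `0`. -/
noncomputable def splitEquiv (m : ℕ) :
    Finset (Fin m) ⊕ Finset (Fin m) ≃ Finset (Fin (m + 1)) :=
  Equiv.ofBijective
    (Sum.elim (fun S => S.map (Fin.succEmb m)) (fun S => insert 0 (S.map (Fin.succEmb m)))) <| by
    have h0 : ∀ S : Finset (Fin m), (0 : Fin (m + 1)) ∉ S.map (Fin.succEmb m) := by
      intro S; simp [Fin.succ_ne_zero]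
    constructor
    · rintro (S | S) (T | T) h
      · simpa using h
      · exact absurd (by simp only [Sum.elim_inl, Sum.elim_inr] at h; rw [h]; simp) (h0 S)
      · exact absurd (by simp only [Sum.elim_inl, Sum.elim_inr] at h; rw [← h]; simp) (h0 T)
      · simp only [Sum.elim_inr] at h
        have := congrArg (fun X => Finset.erase X 0) h
        simp only [Finset.erase_insert (h0 _)] at this
        simpa using this
    · intro T
      have key : (Finset.univ.filter (fun i : Fin m => i.succ ∈ T)).map (Fin.succEmb m)
          = T.erase 0 := by
        ext j
        refine Fin.cases ?_ (fun i => ?_) j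
        · simp [Fin.succ_ne_zero]
        · simp [Fin.succ_ne_zero]
      by_cases hT : (0 : Fin (m + 1)) ∈ T
      · refine ⟨Sum.inr (Finset.univ.filter (fun i : Fin m => i.succ ∈ T)), ?_⟩
        simp only [Sum.elim_inr, key, Finset.insert_erase hT]
      · refine ⟨Sum.inl (Finset.univ.filter (fun i : Fin m => i.succ ∈ T)), ?_⟩
        simp only [Sum.elim_inl, key, Finset.erase_eq_of_notMem hT]

theorem splitEquiv_inl {m : ℕ} (S : Finset (Fin m)) :
    splitEquiv m (Sum.inl S) = S.map (Fin.succEmb m) := rfl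

theorem splitEquiv_inr {m : ℕ} (S : Finset (Fin m)) :
    splitEquiv m (Sum.inr S) = insert 0 (S.map (Fin.succEmb m)) := rfl

theorem pTen_cons' {m : ℕ} (d : F) (c : Fin m → F) (q : QuadraticForm F V) :
    ∃ e : (pTen (Fin.cons d c : Fin (m + 1) → F) q).IsometryEquiv (pDbl d (pTen c q)),
      ∀ f, (e f).1 ∅ = f ∅ := by
  let e : (Finset (Fin (m + 1)) → V) ≃ₗ[F] (Finset (Fin m) → V) × (Finset (Fin m) → V) :=
    (LinearEquiv.funCongrLeft F V (splitEquiv m)).trans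
      (LinearEquiv.sumArrowLequivProdArrow (Finset (Fin m)) (Finset (Fin m)) F V)
  refine ⟨⟨e, fun f => ?_⟩, fun f => ?_⟩
  · change pDbl d (pTen c q) (e f) = pTen (Fin.cons d c : Fin (m + 1) → F) q f
    rw [pDbl_apply, pTen_apply, pTen_apply, pTen_apply, ← (splitEquiv m).sum_comp,
      Fintype.sum_sum_type, Finset.mul_sum]
    congr 1
    · refine Finset.sum_congr rfl (fun S _ => ?_)
      simp [e, splitEquiv_inl, LinearEquiv.funCongrLeft]
    · refine Finset.sum_congr rfl (fun S _ => ?_)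
      have h0 : (0 : Fin (m + 1)) ∉ S.map (Fin.succEmb m) := by simp [Fin.succ_ne_zero]
      simp [e, splitEquiv_inr, LinearEquiv.funCongrLeft, Finset.prod_insert h0, mul_assoc]
  · change (e f).1 ∅ = f ∅
    simp [e, splitEquiv_inl, LinearEquiv.funCongrLeft]

theorem pTen_cons {m : ℕ} (d : F) (c : Fin m → F) (q : QuadraticForm F V) :
    (pTen (Fin.cons d c : Fin (m + 1) → F) q).Equivalent (pDbl d (pTen c q)) :=
  let ⟨e, _⟩ := pTen_cons' d c q
  ⟨e⟩

theorem pTen_zero (c : Fin 0 → F) (q : QuadraticForm F V) : (pTen c q).Equivalent q :=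
  equiv_of (LinearEquiv.funUnique (Finset (Fin 0)) F V) (fun f => by
    rw [pTen_apply, Fintype.sum_unique]
    have : (default : Finset (Fin 0)) = ∅ := Subsingleton.elim _ _
    simp [this])

/-- `⟨⟨z⟩⟩` can be moved inside. -/
theorem pDbl_pTen {m : ℕ} (z : F) (c : Fin m → F) (q : QuadraticForm F V) :
    (pDbl z (pTen c q)).Equivalent (pTen c (pDbl z q)) := by
  induction m with
  | zero => exact (equiv_pDbl z (pTen_zero c q)).trans (pTen_zero c _).symm
  | succ m ih =>
    rw [← Fin.cons_self_tail c]
    exact (equiv_pDbl z (pTen_cons _ _ q)).trans <| (pDbl_swap _ _ _).trans <|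
      (equiv_pDbl _ (ih _)).trans (pTen_cons _ _ _).symm

/-- Round forms. -/
def pRound (q : QuadraticForm F V) : Prop := ∀ x, q x ≠ 0 → q.Equivalent (q x • q)

theorem smul_sq_equiv {c : F} (hc : c ≠ 0) (a : F) (q : QuadraticForm F V) :
    ((c * c * a) • q).Equivalent (a • q) :=
  equiv_of (LinearEquiv.smulOfNeZero F V c hc) (fun v => by
    simp [QuadraticMap.map_smul]; ring)

theorem pRound.equiv {q : QuadraticForm F V} {q' : QuadraticForm F W} (h : q.Equivalent q')
    (hq : pRound q) : pRound q' := by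
  intro x hx
  obtain ⟨e⟩ := h
  have h1 : q (e.symm x) = q' x := by rw [← e.map_app]; simp
  have := hq (e.symm x) (by rwa [h1])
  rw [h1] at this
  exact (Equivalent.symm ⟨e⟩).trans (this.trans (equiv_smul _ ⟨e⟩))

variable [CharP F 2]

theorem two_zero : (2 : F) = 0 := CharTwo.two_eq_zero

theorem binary_equiv (a b : F) (hab : a + b ≠ 0) (q : QuadraticForm F V) :
    (QuadraticMap.prod ((a + b) • q) ((a * b * (a + b)) • q)).Equivalent
      (QuadraticMap.prod (a • q) (b • q)) := by
  let f : V × V →ₗ[F] V × V :=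
    LinearMap.prod (LinearMap.fst F V V + b • LinearMap.snd F V V)
      (LinearMap.fst F V V + a • LinearMap.snd F V V)
  have hf : ∀ v, f v = (v.1 + b • v.2, v.1 + a • v.2) := fun v => by simp [f]
  let g : V × V →ₗ[F] V × V :=
    (a + b)⁻¹ • LinearMap.prod (a • LinearMap.fst F V V + b • LinearMap.snd F V V)
      (LinearMap.fst F V V + LinearMap.snd F V V)
  have hg : ∀ v, g v = ((a + b)⁻¹ • (a • v.1 + b • v.2), (a + b)⁻¹ • (v.1 + v.2)) :=
    fun v => by simp [g]
  have h2 : (2 : F) = 0 := two_zero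
  refine equiv_of (LinearEquiv.ofLinearMap f g ?_ ?_) ?_
  · refine LinearMap.ext fun v => ?_
    rw [LinearMap.comp_apply, hg, hf, LinearMap.id_apply]
    ext
    · match_scalars
      · field_simp
      · field_simp; linear_combination b * h2
    · match_scalars
      · field_simp; linear_combination a * h2
      · field_simp; ring
  · refine LinearMap.ext fun v => ?_
    rw [LinearMap.comp_apply, hf, hg, LinearMap.id_apply]
    ext
    · match_scalars
      · field_simp
      · field_simp; linear_combination a * b * h2
    · match_scalars
      · field_simp; linear_combination h2
      · field_simp; ring
  · intro v
    change (QuadraticMap.prod (a • q) (b • q)) (f v) = _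
    rw [hf]
    simp only [QuadraticMap.prod_apply, _root_.smul_apply, smul_eq_mul,
      QuadraticMap.map_add q, QuadraticMap.map_smul, QuadraticMap.polar_smul_right]
    linear_combination a * b * polar q v.1 v.2 * h2

theorem pRound_pDbl {q : QuadraticForm F V} (hq : pRound q) {c : F} (hc : c ≠ 0) :
    pRound (pDbl c q) := by
  rintro ⟨x, y⟩ hz
  rw [pDbl_apply] at hz ⊢
  simp only at hz ⊢
  by_cases hy : q y = 0
  · rw [hy, mul_zero, add_zero] at hz ⊢
    have h := hq x hz
    have := equiv_pDbl c h
    refine this.trans (equiv_of (LinearEquiv.refl F _) fun v => ?_)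
    simp [pDbl_apply]; ring
  have hyq := hq y hy
  by_cases hx : q x = 0
  · rw [hx, zero_add] at hz ⊢
    have h1 : (c • q).Equivalent ((c * q y) • q) := by
      rw [mul_smul]; exact equiv_smul c hyq
    have h2 : q.Equivalent ((c * c * q y) • q) := hyq.trans (smul_sq_equiv hc _ q).symm
    refine (h2.prod h1).trans ?_
    refine (Equivalent.trans ⟨IsometryEquiv.prodComm _ _⟩ ?_)
    refine equiv_of (LinearEquiv.refl F _) fun v => ?_
    simp [pDbl_apply]; ring
  have hxq := hq x hx
  have h1 : (c • q).Equivalent ((c * q y) • q) := by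
    rw [mul_smul]; exact equiv_smul c hyq
  refine (hxq.prod h1).trans ((binary_equiv _ _ hz q).symm.trans ?_)
  have h2 : (c • q).Equivalent ((q x * (c * q y)) • q) := by
    refine h1.trans ?_
    rw [mul_comm (q x), mul_smul (c * q y)]
    exact equiv_smul _ hxq
  have h3 := (equiv_smul (q x + c * q y) (equiv_pDbl_slot h2)).symm
  refine Equivalent.trans (equiv_of (LinearEquiv.refl F _) fun v => ?_) h3
  simp [pDbl_apply]; ring

theorem pRound_pTen {q : QuadraticForm F V} (hq : pRound q) {m : ℕ} (c : Fin m → F)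
    (hc : ∀ i, c i ≠ 0) : pRound (pTen c q) := by
  induction m with
  | zero => exact pRound.equiv (pTen_zero c q).symm hq
  | succ m ih =>
    rw [← Fin.cons_self_tail c]
    exact pRound.equiv (pTen_cons _ _ q).symm
      (pRound_pDbl (ih (Fin.tail c) (fun i => hc i.succ)) (hc 0))

theorem pRound_pE (a : F) : pRound (pE a) := by
  rintro ⟨p, r⟩ hu
  set u := pE a (p, r) with hu'
  have huv : u = p ^ 2 + p * r + a * r ^ 2 := by rw [hu', pE_apply]
  have h2 : (2 : F) = 0 := two_zero
  let f : F × F →ₗ[F] F × F :=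
    LinearMap.prod (p • LinearMap.fst F F F + (a * r) • LinearMap.snd F F F)
      (r • LinearMap.fst F F F + (p + r) • LinearMap.snd F F F)
  have hf : ∀ v, f v = (p * v.1 + a * r * v.2, r * v.1 + (p + r) * v.2) := fun v => by simp [f]
  let g : F × F →ₗ[F] F × F :=
    u⁻¹ • LinearMap.prod ((p + r) • LinearMap.fst F F F + (a * r) • LinearMap.snd F F F)
      (r • LinearMap.fst F F F + p • LinearMap.snd F F F)
  have hg : ∀ v, g v = (u⁻¹ * ((p + r) * v.1 + a * r * v.2), u⁻¹ * (r * v.1 + p * v.2)) :=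
    fun v => by simp [g]
  refine Equivalent.symm (equiv_of (LinearEquiv.ofLinearMap f g ?_ ?_) ?_)
  · refine LinearMap.ext fun v => ?_
    rw [LinearMap.comp_apply, hg, hf, LinearMap.id_apply]
    ext
    · simp only; field_simp; rw [huv]; linear_combination (v.2 * a * p * r) * h2
    · simp only; field_simp; rw [huv]; linear_combination (v.1 * (p * r + r ^ 2)) * h2
  · refine LinearMap.ext fun v => ?_
    rw [LinearMap.comp_apply, hf, hg, LinearMap.id_apply]
    ext
    · simp only; field_simp; rw [huv]; linear_combination (v.2 * a * r * (p + r)) * h2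
    · simp only; field_simp; rw [huv]; linear_combination (v.1 * p * r) * h2
  · intro v
    change pE a (f v) = (u • pE a) v
    rw [hf, _root_.smul_apply, pE_apply, pE_apply, huv, smul_eq_mul]
    linear_combination (2 * a * p * r * v.1 * v.2 + a * p * r * v.2 ^ 2 + a * r ^ 2 * v.1 * v.2
      + a * r ^ 2 * v.2 ^ 2) * h2

theorem slot_lemma {q : QuadraticForm F V} (hq : pRound q) {m : ℕ} (c : Fin m → F)
    (hc : ∀ i, c i ≠ 0) (f : Finset (Fin m) → V) (hf : f ∅ = 0) (hz : pTen c q f ≠ 0) :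
    ∃ m', m = m' + 1 ∧ ∃ c' : Fin m' → F, (∀ i, c' i ≠ 0) ∧
      (pTen c q).Equivalent (pDbl (pTen c q f) (pTen c' q)) := by
  induction m with
  | zero =>
    exfalso; apply hz
    rw [pTen_apply, Fintype.sum_unique]
    have : (default : Finset (Fin 0)) = ∅ := Subsingleton.elim _ _
    rw [this, hf]; simp
  | succ m ih =>
    refine ⟨m, rfl, ?_⟩
    obtain ⟨d, t, rfl⟩ : ∃ d t, c = (Fin.cons d t : Fin (m + 1) → F) :=
      ⟨c 0, Fin.tail c, (Fin.cons_self_tail c).symm⟩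
    have hd : d ≠ 0 := hc 0
    have ht : ∀ i, t i ≠ 0 := fun i => by simpa using hc i.succ
    obtain ⟨e, he⟩ := pTen_cons' d t q
    have hE : (pTen (Fin.cons d t : Fin (m + 1) → F) q).Equivalent (pDbl d (pTen t q)) := ⟨e⟩
    have hval := e.map_app f
    rw [pDbl_apply] at hval
    have hf0 := he f
    rw [hf] at hf0
    revert hval hf0
    generalize (e f).1 = f0
    generalize (e f).2 = f1
    generalize pTen (Fin.cons d t : Fin (m + 1) → F) q f = z at *
    intro hval hf0
    have hR := pRound_pTen hq t ht
    by_cases hy : pTen t q f1 = 0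
    · rw [hy, mul_zero, add_zero] at hval
      obtain ⟨m', rfl, c', hc', h⟩ := ih t ht f0 hf0 (by rwa [hval])
      rw [hval] at h
      refine ⟨Fin.cons d c', Fin.cases (by simpa using hd) (by simpa using hc'), ?_⟩
      exact hE.trans ((equiv_pDbl d h).trans ((pDbl_swap _ _ _).trans
        (equiv_pDbl z (pTen_cons d c' q).symm)))
    have hdy : (pDbl d (pTen t q)).Equivalent (pDbl (d * pTen t q f1) (pTen t q)) := by
      apply equiv_pDbl_slot
      rw [mul_smul]
      exact equiv_smul d (hR f1 hy)
    by_cases hx : pTen t q f0 = 0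
    · rw [hx, zero_add] at hval
      rw [hval] at hdy
      exact ⟨t, ht, hE.trans hdy⟩
    obtain ⟨m', rfl, c', hc', h⟩ := ih t ht f0 hf0 hx
    generalize pTen t q f0 = x at *
    generalize pTen t q f1 = y at *
    have hxy : x * (d * y) ≠ 0 := mul_ne_zero hx (mul_ne_zero hd hy)
    refine ⟨Fin.cons (x * (d * y)) c', Fin.cases (by simpa using hxy) (by simpa using hc'), ?_⟩
    refine hE.trans (hdy.trans ((equiv_pDbl _ h).trans ?_))
    refine Equivalent.trans ?_ (equiv_pDbl z (pTen_cons _ c' q).symm)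
    generalize pTen c' q = X
    subst hval
    have hb := (binary_equiv x (d * y) hz X).symm
    have h4 : (pDbl (d * y) (pDbl x X)).Equivalent
      (QuadraticMap.prod (QuadraticMap.prod X ((x * (d * y)) • X))
        (QuadraticMap.prod (x • X) ((d * y) • X))) := by
      refine equiv_of ((LinearEquiv.prodProdProdComm F _ _ _ _).trans
        ((LinearEquiv.prodCongr (LinearEquiv.refl F _) (LinearEquiv.prodComm F _ _)).trans
        ((LinearEquiv.prodProdProdComm F _ _ _ _).trans
        (LinearEquiv.prodCongr (LinearEquiv.refl F _) (LinearEquiv.prodComm F _ _))))) ?_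
      intro v
      simp [pDbl_apply]; ring
    refine h4.trans (((Equivalent.refl _).prod hb).trans ?_)
    refine equiv_of (LinearEquiv.refl F _) ?_
    intro v
    simp [pDbl_apply]; ring

theorem aniso_equiv {q : QuadraticForm F V} {q' : QuadraticForm F W} (h : q.Equivalent q')
    (hq : q.Anisotropic) : q'.Anisotropic := by
  obtain ⟨e⟩ := h
  intro x hx
  have h1 : q (e.symm x) = q' x := by rw [← e.map_app]; simp
  have h2 := hq (e.symm x) (by rw [h1, hx])
  have h3 : e (e.symm x) = e 0 := by rw [h2]
  rw [e.apply_symm_apply] at h3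
  rw [h3]
  exact map_zero e.toLinearEquiv

theorem pE_zero_smul {d : F} (hd : d ≠ 0) : (d • pE (0 : F)).Equivalent (pE (0 : F)) := by
  have h2 : (2 : F) = 0 := two_zero
  let f : F × F →ₗ[F] F × F :=
    LinearMap.prod (d • LinearMap.fst F F F)
      ((1 + d) • LinearMap.fst F F F + LinearMap.snd F F F)
  have hf : ∀ v, f v = (d * v.1, (1 + d) * v.1 + v.2) := fun v => by simp [f]
  let g : F × F →ₗ[F] F × F :=
    LinearMap.prod (d⁻¹ • LinearMap.fst F F F)
      (((1 + d) * d⁻¹) • LinearMap.fst F F F + LinearMap.snd F F F)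
  have hg : ∀ v, g v = (d⁻¹ * v.1, (1 + d) * d⁻¹ * v.1 + v.2) := fun v => by simp [g]
  refine equiv_of (LinearEquiv.ofLinearMap f g ?_ ?_) ?_
  · refine LinearMap.ext fun v => ?_
    rw [LinearMap.comp_apply, hg, hf, LinearMap.id_apply]
    ext
    · simp only; field_simp
    · simp only; field_simp; linear_combination ((1 + d) * v.1) * h2
  · refine LinearMap.ext fun v => ?_
    rw [LinearMap.comp_apply, hf, hg, LinearMap.id_apply]
    ext
    · simp only; field_simp
    · simp only; field_simp; linear_combination ((1 + d) * v.1) * h2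
  · intro v
    change pE 0 (f v) = (d • pE 0) v
    rw [hf, _root_.smul_apply, pE_apply, pE_apply, smul_eq_mul]
    linear_combination (d ^ 2 * v.1 ^ 2) * h2

/-- The standard hyperbolic form. -/
def pHyp (F : Type u) [Field F] (m : ℕ) : QuadraticForm F (Finset (Fin m) → F × F) :=
  pTen (fun _ => 1) (pE 0)

theorem pTen_pE_zero {m : ℕ} (c : Fin m → F) (hc : ∀ i, c i ≠ 0) :
    (pTen c (pE (0 : F))).Equivalent (pHyp F m) :=
  Equivalent.pi (fun T => by
    simp only [Finset.prod_const_one, one_smul]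
    exact pE_zero_smul (Finset.prod_ne_zero_iff.2 fun i _ => hc i))

theorem pDbl_one_pE (a : F) : (pDbl 1 (pE a)).Equivalent (pDbl 1 (pE 0)) := by
  have h2 : (2 : F) = 0 := two_zero
  let f : (F × F) × (F × F) →ₗ[F] (F × F) × (F × F) :=
    { toFun := fun v => ((v.1.1 + v.2.1, v.2.2),
        (v.1.2 + v.2.2, v.1.1 + (a + 1) * (v.1.2 + v.2.2)))
      map_add' := fun v w => by ext <;> simp <;> ring
      map_smul' := fun c v => by ext <;> simp <;> ring }
  have hf : ∀ v, f v = ((v.1.1 + v.2.1, v.2.2),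
        (v.1.2 + v.2.2, v.1.1 + (a + 1) * (v.1.2 + v.2.2))) := fun v => rfl
  let g : (F × F) × (F × F) →ₗ[F] (F × F) × (F × F) :=
    { toFun := fun v => ((v.2.2 + (a + 1) * v.2.1, v.2.1 + v.1.2),
        (v.1.1 + v.2.2 + (a + 1) * v.2.1, v.1.2))
      map_add' := fun v w => by ext <;> simp <;> ring
      map_smul' := fun c v => by ext <;> simp <;> ring }
  have hg : ∀ v, g v = ((v.2.2 + (a + 1) * v.2.1, v.2.1 + v.1.2),
        (v.1.1 + v.2.2 + (a + 1) * v.2.1, v.1.2)) := fun v => rfl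
  refine equiv_of (LinearEquiv.ofLinearMap f g ?_ ?_) ?_
  · refine LinearMap.ext fun v => ?_
    obtain ⟨⟨x, y⟩, ⟨z, w⟩⟩ := v
    rw [LinearMap.comp_apply, hg, hf, LinearMap.id_apply]
    refine Prod.ext (Prod.ext ?_ ?_) (Prod.ext ?_ ?_) <;> simp only
    · linear_combination (w + (a + 1) * z) * h2
    · linear_combination y * h2
    · linear_combination ((a + 1) * (z + y)) * h2
  · refine LinearMap.ext fun v => ?_
    obtain ⟨⟨x, y⟩, ⟨z, w⟩⟩ := v
    rw [LinearMap.comp_apply, hf, hg, LinearMap.id_apply]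
    refine Prod.ext (Prod.ext ?_ ?_) (Prod.ext ?_ ?_) <;> simp only
    · linear_combination ((a + 1) * (y + w)) * h2
    · linear_combination w * h2
    · linear_combination (x + (a + 1) * (y + w)) * h2
  · rintro ⟨⟨x, y⟩, ⟨z, w⟩⟩
    change pDbl 1 (pE 0) (f _) = _
    rw [hf]
    simp only [pDbl_apply, pE_apply]
    linear_combination (x * z + x * w + y * w + a * y * w + y ^ 2 + w ^ 2 + y * w) * h2

theorem pDbl_one_pTen (a : F) {m : ℕ} (c : Fin m → F) (hc : ∀ i, c i ≠ 0) :
    (pDbl 1 (pTen c (pE a))).Equivalent (pHyp F (m + 1)) := by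
  refine (pDbl_pTen 1 c _).trans ((equiv_pTen c (pDbl_one_pE a)).trans
    ((pDbl_pTen 1 c _).symm.trans ((pTen_cons 1 c _).symm.trans ?_)))
  exact pTen_pE_zero _ (Fin.cases (by simp) (by simpa using hc))

theorem pE_isotropic (a : F) (h : ¬ (pE a).Anisotropic) : (pE a).Equivalent (pE (0 : F)) := by
  rw [QuadraticMap.not_anisotropic_iff_exists] at h
  obtain ⟨⟨x, y⟩, hne, h⟩ := h
  rw [pE_apply] at h
  simp only at h
  have h2 : (2 : F) = 0 := two_zero
  have hy : y ≠ 0 := by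
    rintro rfl
    have : x = 0 := by simpa using h
    exact hne (by rw [this]; rfl)
  obtain ⟨s, hs⟩ : ∃ s : F, s ^ 2 + s + a = 0 := by
    refine ⟨x / y, ?_⟩
    field_simp
    linear_combination h
  let f : F × F →ₗ[F] F × F :=
    LinearMap.prod (LinearMap.fst F F F + s • LinearMap.snd F F F) (LinearMap.snd F F F)
  have hf : ∀ v, f v = (v.1 + s * v.2, v.2) := fun v => by simp [f]
  have hff : f.comp f = LinearMap.id := by
    refine LinearMap.ext fun v => ?_
    rw [LinearMap.comp_apply, hf, hf, LinearMap.id_apply]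
    refine Prod.ext ?_ rfl
    simp only
    linear_combination (s * v.2) * h2
  refine equiv_of (LinearEquiv.ofLinearMap f f hff hff) ?_
  intro v
  change pE 0 (f v) = _
  rw [hf, pE_apply, pE_apply]
  simp only
  linear_combination v.2 ^ 2 * hs + (s * v.1 * v.2 - a * v.2 ^ 2) * h2

theorem pTen_isotropic (a : F) {m : ℕ} (c : Fin m → F) (hc : ∀ i, c i ≠ 0)
    (h : ¬ (pTen c (pE a)).Anisotropic) : (pTen c (pE a)).Equivalent (pHyp F m) := by
  induction m with
  | zero =>
    have h' : ¬ (pE a).Anisotropic := fun h' => h (aniso_equiv (pTen_zero c _).symm h')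
    exact (equiv_pTen c (pE_isotropic a h')).trans (pTen_pE_zero c hc)
  | succ m ih =>
    obtain ⟨d, t, rfl⟩ : ∃ d t, c = (Fin.cons d t : Fin (m + 1) → F) :=
      ⟨c 0, Fin.tail c, (Fin.cons_self_tail c).symm⟩
    have hd : d ≠ 0 := hc 0
    have ht : ∀ i, t i ≠ 0 := fun i => by simpa using hc i.succ
    by_cases hX : (pTen t (pE a)).Anisotropic
    · have h' : ¬ (pDbl d (pTen t (pE a))).Anisotropic :=
        fun h' => h (aniso_equiv (pTen_cons d t _).symm h')
      rw [QuadraticMap.not_anisotropic_iff_exists] at h'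
      obtain ⟨⟨x, y⟩, hne, h'⟩ := h'
      rw [pDbl_apply] at h'
      simp only at h'
      have hR := pRound_pTen (pRound_pE a) t ht
      refine (pTen_cons d t _).trans (Equivalent.trans ?_ (pDbl_one_pTen a t ht))
      apply equiv_pDbl_slot
      rw [one_smul]
      generalize pTen t (pE a) = X at *
      have hxy : X x = d * X y := by
        linear_combination h' - d * X y * (two_zero : (2 : F) = 0)
      have hy : X y ≠ 0 := by
        intro hy
        rw [hy, mul_zero] at hxy
        exact hne (Prod.ext (hX x hxy) (hX y hy))
      have hx : X x ≠ 0 := by rw [hxy]; exact mul_ne_zero hd hy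
      have h3 := equiv_smul d (hR y hy)
      rw [← mul_smul, ← hxy] at h3
      exact h3.trans (hR x hx).symm
    · refine (pTen_cons d t _).trans ((equiv_pDbl d (ih t ht hX)).trans
        ((pTen_cons d _ _).symm.trans (pTen_pE_zero _ (Fin.cases (by simpa using hd) (by simp)))))

theorem pTen_pTen {k m : ℕ} (b : Fin k → F) (hb : ∀ i, b i ≠ 0) (c : Fin m → F)
    (hc : ∀ i, c i ≠ 0) (q : QuadraticForm F V) :
    ∃ s : Fin (k + m) → F, (∀ i, s i ≠ 0) ∧ (pTen c (pTen b q)).Equivalent (pTen s q) := by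
  induction m with
  | zero => exact ⟨b, hb, pTen_zero _ _⟩
  | succ m ih =>
    obtain ⟨d, t, rfl⟩ : ∃ d t, c = (Fin.cons d t : Fin (m + 1) → F) :=
      ⟨c 0, Fin.tail c, (Fin.cons_self_tail c).symm⟩
    obtain ⟨s, hs, h⟩ := ih t (fun i => by simpa using hc i.succ)
    refine ⟨(Fin.cons d s : Fin (k + m + 1) → F),
      Fin.cases (by simpa using hc 0) (by simpa using hs), ?_⟩
    exact (pTen_cons d t _).trans ((equiv_pDbl d h).trans (pTen_cons d s q).symm)

theorem hyp_case {k m : ℕ} (b : Fin k → F) (hb : ∀ i, b i ≠ 0) (b0 : F) :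
    (pTen (fun _ : Fin (m + 1) => (1 : F)) (pTen b (pE b0))).Equivalent
      (pHyp F (k + (m + 1))) := by
  obtain ⟨s, hs, h⟩ := pTen_pTen b hb (fun _ : Fin (m + 1) => (1 : F)) (by simp) (pE b0)
  refine h.trans (pTen_isotropic b0 s hs fun hA => ?_)
  have h1 : (fun _ : Fin (m + 1) => (1 : F)) = Fin.cons 1 (fun _ : Fin m => (1 : F)) := by
    funext i; refine Fin.cases rfl (fun _ => rfl) i
  have hB := aniso_equiv h.symm hA
  rw [h1] at hB
  have hC := aniso_equiv (pTen_cons (1 : F) (fun _ : Fin m => (1 : F)) (pTen b (pE b0))) hB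
  have hD := hC ((fun _ => fun _ => (1, 0)), (fun _ => fun _ => (1, 0))) (by
    rw [pDbl_apply]; simp only; linear_combination
      (pTen (fun _ : Fin m => (1 : F)) (pTen b (pE b0)) (fun _ => fun _ => (1, 0))) *
        (two_zero : (2 : F) = 0))
  have := congrArg (fun v => (v.1 ∅ ∅).1) hD
  simp at this

theorem exists_isometry {ψ : QuadraticForm F V} (hA : ψ.Anisotropic) (v w : V)
    (h : ψ v = ψ w) : ∃ g : ψ.IsometryEquiv ψ, g v = w := by
  by_cases hd : ψ (v - w) = 0
  · exact ⟨QuadraticMap.IsometryEquiv.refl ψ, sub_eq_zero.1 (hA _ hd)⟩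
  have hs : ψ (v - w) = 2 * ψ v - polar ψ v w := by
    have := QuadraticMap.map_add ψ v (-w)
    rw [← sub_eq_add_neg] at this
    rw [this, QuadraticMap.map_neg, QuadraticMap.polar_neg_right, ← h]; ring
  let f : Module.Dual F V := (ψ (v - w))⁻¹ • (ψ.polarBilin (v - w))
  have hf : ∀ y, f y = (ψ (v - w))⁻¹ * polar ψ (v - w) y := fun y => by simp [f]
  have hf2 : f (v - w) = 2 := by
    rw [hf, QuadraticMap.polar_self]
    rw [nsmul_eq_mul]; push_cast; field_simp
  refine ⟨⟨Module.reflection hf2, fun y => ?_⟩, ?_⟩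
  · change ψ (Module.reflection hf2 y) = ψ y
    rw [Module.reflection_apply, hf, sub_eq_add_neg, QuadraticMap.map_add ψ, QuadraticMap.map_neg,
      QuadraticMap.polar_neg_right, QuadraticMap.map_smul, QuadraticMap.polar_smul_right,
      QuadraticMap.polar_comm ψ y, smul_eq_mul, smul_eq_mul]
    field_simp
    ring
  · change Module.reflection hf2 v = w
    have : f v = 1 := by
      rw [hf, QuadraticMap.polar_sub_left, QuadraticMap.polar_self, QuadraticMap.polar_comm ψ w v,
        nsmul_eq_mul, Nat.cast_ofNat, ← hs]
      exact inv_mul_cancel₀ hd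
    rw [Module.reflection_apply, this, one_smul, sub_sub_cancel]

theorem polar_iso {q : QuadraticForm F V} {q' : QuadraticForm F W} (e : q.IsometryEquiv q')
    (x y : V) : polar q' (e x) (e y) = polar q x y := by
  have : e x + e y = e (x + y) := (map_add e.toLinearEquiv x y).symm
  simp only [polar, this, e.map_app]

theorem pTen_single {m : ℕ} (c : Fin m → F) (q : QuadraticForm F V) (x : V) :
    pTen c q (Pi.single ∅ x) = q x := by
  rw [pTen_apply, Finset.sum_eq_single ∅]
  · simp
  · intro T _ hT; simp [hT]
  · simp

theorem polar_pTen_single {m : ℕ} (c : Fin m → F) (q : QuadraticForm F V)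
    (f : Finset (Fin m) → V) (x : V) :
    polar (pTen c q) f (Pi.single ∅ x) = polar q (f ∅) x := by
  simp only [polar, pTen_apply, ← Finset.sum_sub_distrib]
  rw [Finset.sum_eq_single ∅]
  · simp
  · intro T _ hT; simp [hT]
  · simp

theorem exists_common {U : Type u} [AddCommGroup U] [Module F U]
    {ψ : QuadraticForm F U} (hA : ψ.Anisotropic)
    [FiniteDimensional F V] [FiniteDimensional F W]
    {φ₁ : QuadraticForm F V} {φ₂ : QuadraticForm F W}
    (x₁ y₁ : V) (hx₁ : φ₁ x₁ = 1) (hxy₁ : polar φ₁ y₁ x₁ ≠ 0) (x₂ : W) (hx₂ : φ₂ x₂ = 1)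
    {m : ℕ} (r₁ r₂ : Fin (m + 1) → F)
    (h₁ : ψ.Equivalent (pTen r₁ φ₁)) (h₂ : ψ.Equivalent (pTen r₂ φ₂)) :
    ∃ z : F, z ≠ 0 ∧ (∃ f, f ∅ = 0 ∧ pTen r₁ φ₁ f = z) ∧ (∃ f, f ∅ = 0 ∧ pTen r₂ φ₂ f = z) := by
  obtain ⟨e₁'⟩ := h₁
  obtain ⟨e₂⟩ := h₂
  obtain ⟨g, hg⟩ := exists_isometry hA (e₂.symm (Pi.single ∅ x₂)) (e₁'.symm (Pi.single ∅ x₁)) (by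
    rw [IsometryEquiv.map_app, IsometryEquiv.map_app, pTen_single, pTen_single, hx₁, hx₂])
  let e₁ : ψ.IsometryEquiv (pTen r₁ φ₁) := g.trans e₁'
  set v := e₂.symm (Pi.single ∅ x₂) with hv
  have hv₁ : e₁ v = Pi.single ∅ x₁ := by
    change e₁' (g v) = _
    rw [hg]; simp
  have hv₂ : e₂ v = Pi.single ∅ x₂ := by simp [hv]
  let P : U →ₗ[F] V × W := LinearMap.prod
    ((LinearMap.proj ∅ : (Finset (Fin (m + 1)) → V) →ₗ[F] V).comp e₁.toLinearEquiv.toLinearMap)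
    ((LinearMap.proj ∅ : (Finset (Fin (m + 1)) → W) →ₗ[F] W).comp e₂.toLinearEquiv.toLinearMap)
  have hP : ∀ u, P u = (e₁ u ∅, e₂ u ∅) := fun u => rfl
  have : FiniteDimensional F U := Module.Finite.equiv e₁.toLinearEquiv.symm
  have hd₁ := e₁.toLinearEquiv.finrank_eq
  have hd₂ := e₂.toLinearEquiv.finrank_eq
  rw [Module.finrank_pi_fintype] at hd₁ hd₂
  simp only [Finset.sum_const, Finset.card_univ, Fintype.card_finset, Fintype.card_fin,
    smul_eq_mul, pow_succ] at hd₁ hd₂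
  have hpos : 1 ≤ 2 ^ m := Nat.one_le_two_pow
  have hle : Module.finrank F (V × W) ≤ Module.finrank F U := by
    rw [Module.finrank_prod]
    nlinarith
  have hninj : ¬ Function.Injective P := by
    intro hinj
    have heq : Module.finrank F U = Module.finrank F (V × W) :=
      le_antisymm (LinearMap.finrank_le_finrank_of_injective hinj) hle
    have hsurj := (LinearMap.injective_iff_surjective_of_finrank_eq_finrank heq).1 hinj
    obtain ⟨u, hu⟩ := hsurj (y₁, 0)
    rw [hP, Prod.mk.injEq] at hu
    have a1 := polar_iso e₁ u v
    have a2 := polar_iso e₂ u v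
    rw [hv₁, polar_pTen_single, hu.1] at a1
    rw [hv₂, polar_pTen_single, hu.2, QuadraticMap.polar_zero_left] at a2
    exact hxy₁ (a1.trans a2.symm)
  rw [← LinearMap.ker_eq_bot, Submodule.eq_bot_iff] at hninj
  push Not at hninj
  obtain ⟨u, hu, hu0⟩ := hninj
  rw [LinearMap.mem_ker, hP, Prod.mk_eq_zero] at hu
  exact ⟨ψ u, fun h => hu0 (hA u h), ⟨e₁ u, hu.1, e₁.map_app u⟩, ⟨e₂ u, hu.2, e₂.map_app u⟩⟩

theorem aniso_case {U : Type u} [AddCommGroup U] [Module F U]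
    {ψ : QuadraticForm F U} (hA : ψ.Anisotropic) (m : ℕ) :
    ∀ {V W : Type u} [AddCommGroup V] [Module F V] [AddCommGroup W] [Module F W]
    [FiniteDimensional F V] [FiniteDimensional F W]
    (φ₁ : QuadraticForm F V) (φ₂ : QuadraticForm F W) (_ : pRound φ₁) (_ : pRound φ₂)
    (x₁ y₁ : V) (_ : φ₁ x₁ = 1) (_ : polar φ₁ y₁ x₁ ≠ 0) (x₂ : W) (_ : φ₂ x₂ = 1)
    (r₁ r₂ : Fin m → F) (_ : ∀ i, r₁ i ≠ 0) (_ : ∀ i, r₂ i ≠ 0)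
    (_ : ψ.Equivalent (pTen r₁ φ₁)) (_ : ψ.Equivalent (pTen r₂ φ₂)),
    ∃ c : Fin m → F, (∀ i, c i ≠ 0) ∧ ψ.Equivalent (pTen c φ₁) ∧ ψ.Equivalent (pTen c φ₂) := by
  induction m with
  | zero =>
    intro V W _ _ _ _ _ _ φ₁ φ₂ _ _ x₁ y₁ _ _ x₂ _ r₁ r₂ hr₁ _ h₁ h₂
    have : r₂ = r₁ := Subsingleton.elim _ _
    exact ⟨r₁, hr₁, h₁, this ▸ h₂⟩
  | succ m ih =>
    intro V W _ _ _ _ _ _ φ₁ φ₂ hR₁ hR₂ x₁ y₁ hx₁ hxy₁ x₂ hx₂ r₁ r₂ hr₁ hr₂ h₁ h₂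
    obtain ⟨z, hz, ⟨f₁, hf₁, hz₁⟩, ⟨f₂, hf₂, hz₂⟩⟩ :=
      exists_common hA x₁ y₁ hx₁ hxy₁ x₂ hx₂ r₁ r₂ h₁ h₂
    obtain ⟨m₁, hm₁, s₁, hs₁, k₁⟩ := slot_lemma hR₁ r₁ hr₁ f₁ hf₁ (by rwa [hz₁])
    obtain ⟨m₂, hm₂, s₂, hs₂, k₂⟩ := slot_lemma hR₂ r₂ hr₂ f₂ hf₂ (by rwa [hz₂])
    obtain rfl : m = m₁ := by omega
    obtain rfl : m = m₂ := by omega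
    rw [hz₁] at k₁
    rw [hz₂] at k₂
    obtain ⟨c, hc, g₁, g₂⟩ := ih (pDbl z φ₁) (pDbl z φ₂) (pRound_pDbl hR₁ hz) (pRound_pDbl hR₂ hz)
      (x₁, 0) (y₁, 0) (by simp [pDbl_apply, hx₁]) (by simpa [polar, pDbl_apply] using hxy₁)
      (x₂, 0) (by simp [pDbl_apply, hx₂]) s₁ s₂ hs₁ hs₂
      (h₁.trans (k₁.trans (pDbl_pTen z s₁ φ₁))) (h₂.trans (k₂.trans (pDbl_pTen z s₂ φ₂)))
    refine ⟨Fin.cons z c, Fin.cases (by simpa using hz) (by simpa using hc), ?_, ?_⟩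
    · exact g₁.trans ((pDbl_pTen z c φ₁).symm.trans (pTen_cons z c φ₁).symm)
    · exact g₂.trans ((pDbl_pTen z c φ₂).symm.trans (pTen_cons z c φ₂).symm)

theorem core {p k m : ℕ} (hp : p = k + (m + 1)) (a : Fin p → F) (ha : ∀ i, a i ≠ 0) (a0 : F)
    (b₁ : Fin k → F) (hb₁ : ∀ i, b₁ i ≠ 0) (b₁0 : F)
    (b₂ : Fin k → F) (hb₂ : ∀ i, b₂ i ≠ 0) (b₂0 : F)
    (r₁ r₂ : Fin (m + 1) → F) (hr₁ : ∀ i, r₁ i ≠ 0) (hr₂ : ∀ i, r₂ i ≠ 0)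
    (h₁ : (pTen a (pE a0)).Equivalent (pTen r₁ (pTen b₁ (pE b₁0))))
    (h₂ : (pTen a (pE a0)).Equivalent (pTen r₂ (pTen b₂ (pE b₂0)))) :
    ∃ c : Fin (m + 1) → F, (∀ i, c i ≠ 0) ∧
      (pTen a (pE a0)).Equivalent (pTen c (pTen b₁ (pE b₁0))) ∧
      (pTen a (pE a0)).Equivalent (pTen c (pTen b₂ (pE b₂0))) := by
  subst hp
  by_cases hA : (pTen a (pE a0)).Anisotropic
  · refine aniso_case hA (m + 1) (pTen b₁ (pE b₁0)) (pTen b₂ (pE b₂0))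
      (pRound_pTen (pRound_pE _) _ hb₁) (pRound_pTen (pRound_pE _) _ hb₂)
      (Pi.single ∅ (1, 0)) (Pi.single ∅ (0, 1)) ?_ ?_ (Pi.single ∅ (1, 0)) ?_ r₁ r₂ hr₁ hr₂ h₁ h₂
    · rw [pTen_single, pE_apply]; simp
    · rw [polar_pTen_single]; simp [polar, pE_apply]
    · rw [pTen_single, pE_apply]; simp
  · have hH := pTen_isotropic a0 a ha hA
    exact ⟨fun _ => 1, by simp, hH.trans (hyp_case b₁ hb₁ b₁0).symm,
      hH.trans (hyp_case b₂ hb₂ b₂0).symm⟩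

theorem bridge {p k m : ℕ} (a : Fin p → F) (a0 : F) (c : Fin m → F) (b : Fin k → F) (b0 : F) :
    QuadIsometric (quadPfister a a0) (bilinTensorQuadPfister c b b0) ↔
      (pTen a (pE a0)).Equivalent (pTen c (pTen b (pE b0))) := by
  have ha : ∀ v, quadPfister a a0 v = pTen a (pE a0) v := fun v => by
    simp only [quadPfister, pTen_apply, pE_apply]
  let C : (Finset (Fin m) × Finset (Fin k) → F × F) ≃ₗ[F]
      (Finset (Fin m) → Finset (Fin k) → F × F) := LinearEquiv.curry F (F × F) _ _
  have hb : ∀ v, bilinTensorQuadPfister c b b0 v = pTen c (pTen b (pE b0)) (C v) := fun v => by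
    simp only [bilinTensorQuadPfister, pTen_apply, pE_apply, Finset.mul_sum, mul_assoc]
    rfl
  constructor
  · rintro ⟨e, he⟩
    refine equiv_of (e.trans C) fun v => ?_
    rw [LinearEquiv.trans_apply, ← hb, he, ha]
  · rintro ⟨e⟩
    refine ⟨e.toLinearEquiv.trans C.symm, fun v => ?_⟩
    rw [hb, ha, LinearEquiv.trans_apply, LinearEquiv.apply_symm_apply]
    exact e.map_app v

end PfisterAux

/-- Lemma (Chapman–Levin): over a field `F` of characteristic 2, given `n > k ≥ 1`, a
quadratic `n`-fold Pfister form `ψ = ⟨⟨a₁,…,a_{n-1},a₀]]` and two quadratic `k`-fold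
Pfister factors `φ₁ = ⟨⟨b₁,…]]`, `φ₂ = ⟨⟨b₂,…]]` of `ψ` (i.e. `ψ ≅ ρ₁ ⊗ φ₁` and
`ψ ≅ ρ₂ ⊗ φ₂` for some bilinear Pfister forms `ρ₁, ρ₂`), there is a single `(n-k)`-fold
bilinear Pfister form `ρ = ⟨⟨c₁,…,c_{n-k}⟩⟩` with `ψ ≅ ρ ⊗ φ₁` and `ψ ≅ ρ ⊗ φ₂`. -/
theorem common_bilinear_pfister_factor
    {F : Type*} [Field F] [CharP F 2] {n k : ℕ} (hk : 1 ≤ k) (hkn : k < n)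
    (a : Fin (n - 1) → F) (ha : ∀ i, a i ≠ 0) (a0 : F)
    (b₁ : Fin (k - 1) → F) (hb₁ : ∀ i, b₁ i ≠ 0) (b₁0 : F)
    (b₂ : Fin (k - 1) → F) (hb₂ : ∀ i, b₂ i ≠ 0) (b₂0 : F)
    (r₁ : Fin (n - k) → F) (hr₁ : ∀ i, r₁ i ≠ 0)
    (r₂ : Fin (n - k) → F) (hr₂ : ∀ i, r₂ i ≠ 0)
    (h₁ : QuadIsometric (quadPfister a a0) (bilinTensorQuadPfister r₁ b₁ b₁0))
    (h₂ : QuadIsometric (quadPfister a a0) (bilinTensorQuadPfister r₂ b₂ b₂0)) :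
    ∃ c : Fin (n - k) → F, (∀ i, c i ≠ 0) ∧
      QuadIsometric (quadPfister a a0) (bilinTensorQuadPfister c b₁ b₁0) ∧
      QuadIsometric (quadPfister a a0) (bilinTensorQuadPfister c b₂ b₂0) := by
  obtain ⟨m, hm⟩ : ∃ m, n - k = m + 1 := ⟨n - k - 1, by omega⟩
  have hp : n - 1 = (k - 1) + (m + 1) := by omega
  simp only [bridge] at h₁ h₂ ⊢
  revert r₁ r₂
  rw [hm]
  intro r₁ hr₁ r₂ hr₂ h₁ h₂
  exact core hp a ha a0 b₁ hb₁ b₁0 b₂ hb₂ b₂0 r₁ r₂ hr₁ hr₂ h₁ h₂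
end
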